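/- Let A = (Q, Σ, δ) be a strongly connected synchronizing partial DFA with Q = {1,…,n}, and let W₁, W₂ ⊆ Σ* be non-empty sets of words; let R = ⋃_{w∈W₁} δ(Q,w) and assume R ≠ ∅, and let A^{I(W₁,W₂)} = (R, W₂W₁, δ') be the induced automaton. If W₂ is complete for V(Q) = ℝⁿ, then W₂W₁ is complete for V(R), and A^{I(W₁,W₂)} is synchronizing and strongly connected. -/

import Mathlib

open scoped Classical

section Defs

variable {Q A : Type*}

/-- Action of a word in a partial DFA with transition function `δ`
(`none` means the undefined value ⊥). -/
def stepWord (δ : Q → A → Option Q) : Q → List A → Option Q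
  | q, [] => some q
  | q, a :: w => (δ q a).bind (fun p => stepWord δ p w)

/-- The image `δ(S, w)` of a set of states under the action of a word. -/
def img (δ : Q → A → Option Q) (S : Set Q) (w : List A) : Set Q :=
  {p | ∃ q ∈ S, stepWord δ q w = some p}

/-- The inseparability equivalence `p ≡ q`. -/
def Insep (δ : Q → A → Option Q) (p q : Q) : Prop :=
  ∀ u : List A, (stepWord δ p u).isSome ↔ (stepWord δ q u).isSome

/-- `κ(S)`: the number of inseparability classes intersecting `S`. -/
noncomputable def kappa (δ : Q → A → Option Q) (S : Set Q) : ℕ :=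
  {C : Set Q | ∃ p ∈ S, C = {q | Insep δ p q}}.ncard

def StronglyConnected (δ : Q → A → Option Q) : Prop :=
  ∀ p q : Q, ∃ w : List A, stepWord δ p w = some q

/-- The transition function of the fixing automaton `A^F`. -/
def fixDelta (δ : Q → A → Option Q) (q : Q) (a : A) : Q := (δ q a).getD q

/-- Action of a word in a complete DFA. -/
def stepWordC (δc : Q → A → Q) (q : Q) (w : List A) : Q := w.foldl δc q

/-- The image of a set of states under the action of a word in a complete DFA. -/
def imgC (δc : Q → A → Q) (S : Set Q) (w : List A) : Set Q :=
  (fun q => stepWordC δc q w) '' S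

end Defs

variable {Q A : Type*}

/-- The 0-1 matrix `M(w)` of the action of the word `w` in a partial DFA. -/
noncomputable def wordMatrix [Fintype Q] (δ : Q → A → Option Q) (w : List A) :
    Matrix Q Q ℝ :=
  fun p q => if stepWord δ p w = some q then 1 else 0

/-- `V(S)`: the subspace of row vectors spanned by the characteristic vectors of the
states in `S`. -/
noncomputable def spanOf [Fintype Q] (S : Set Q) : Submodule ℝ (Q → ℝ) :=
  Submodule.span ℝ {v : Q → ℝ | ∃ p ∈ S, v = Pi.single p 1}

/-- A set of words `W` is complete for a subspace `V` if for every non-negative non-zero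
row vector `g ∈ V` we have `V ⊆ span {g·M(w) | w ∈ W}`. -/
def CompleteFor [Fintype Q] (δ : Q → A → Option Q) (W : Set (List A))
    (V : Submodule ℝ (Q → ℝ)) : Prop :=
  ∀ g : Q → ℝ, g ∈ V → (∀ i, 0 ≤ g i) → g ≠ 0 →
    V ≤ Submodule.span ℝ {v : Q → ℝ | ∃ w ∈ W, v = Matrix.vecMul g (wordMatrix δ w)}

/-- The product set of words `W₂W₁` (first read a word of `W₂`, then one of `W₁`). -/
def wordProd (W₂ W₁ : Set (List A)) : Set (List A) :=
  {u | ∃ w₂ ∈ W₂, ∃ w₁ ∈ W₁, u = w₂ ++ w₁}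

theorem stepWord_append (δ : Q → A → Option Q) (q : Q) (u v : List A) :
    stepWord δ q (u ++ v) = (stepWord δ q u).bind (fun p => stepWord δ p v) := by
  induction u generalizing q with
  | nil => rfl
  | cons a u ih =>
    simp only [List.cons_append, stepWord]
    cases δ q a with
    | none => rfl
    | some p => exact ih p

theorem stepWord_append_eq_some (δ : Q → A → Option Q) (q r : Q) (u v : List A) :
    stepWord δ q (u ++ v) = some r ↔ ∃ p, stepWord δ q u = some p ∧ stepWord δ p v = some r := by
  rw [stepWord_append, Option.bind_eq_some_iff]

theorem wordMatrix_append [Fintype Q] (δ : Q → A → Option Q) (u v : List A) :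
    wordMatrix δ (u ++ v) = wordMatrix δ u * wordMatrix δ v := by
  ext p r
  rw [Matrix.mul_apply]
  simp only [wordMatrix, stepWord_append]
  cases h : stepWord δ p u with
  | none => simp
  | some s =>
    rw [Finset.sum_eq_single s]
    · simp
    · intro x _ hx
      simp [hx.symm]
    · simp

theorem vecMul_append [Fintype Q] (δ : Q → A → Option Q) (g : Q → ℝ) (u v : List A) :
    Matrix.vecMul g (wordMatrix δ (u ++ v)) =
      Matrix.vecMul (Matrix.vecMul g (wordMatrix δ u)) (wordMatrix δ v) := by
  rw [wordMatrix_append, Matrix.vecMul_vecMul]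

theorem single_vecMul_wordMatrix_apply [Fintype Q] (δ : Q → A → Option Q) (p q : Q)
    (w : List A) :
    Matrix.vecMul (Pi.single p 1) (wordMatrix δ w) q =
      if stepWord δ p w = some q then 1 else 0 := by
  rw [Matrix.single_one_vecMul]
  rfl

theorem single_vecMul_wordMatrix [Fintype Q] (δ : Q → A → Option Q) (p q : Q) (w : List A)
    (h : stepWord δ p w = some q) :
    Matrix.vecMul (Pi.single p 1) (wordMatrix δ w) = Pi.single q 1 := by
  ext r
  rw [single_vecMul_wordMatrix_apply, h, Pi.single_apply]
  simp [eq_comm]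

theorem mem_spanOf_univ [Fintype Q] (g : Q → ℝ) : g ∈ spanOf (Set.univ : Set Q) := by
  have hg : g = ∑ i, g i • (Pi.single i (1 : ℝ) : Q → ℝ) := by
    ext j
    simp [Finset.sum_apply, Pi.single_apply]
  rw [hg]
  exact Submodule.sum_mem _ fun i _ =>
    Submodule.smul_mem _ _ (Submodule.subset_span ⟨i, Set.mem_univ i, rfl⟩)

/-- If `W₂` is complete for the whole space, then for every non-negative non-zero `g` the vectors
`g·M(u)` with `u ∈ W₂W₁` span every characteristic vector of a state in the image of `W₁`. -/
theorem spanOf_le_span_wordProd [Fintype Q] (δ : Q → A → Option Q) (W₁ W₂ : Set (List A))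
    (hcomp : CompleteFor δ W₂ (spanOf (Set.univ : Set Q)))
    (g : Q → ℝ) (hg : ∀ i, 0 ≤ g i) (hg0 : g ≠ 0) :
    spanOf {p : Q | ∃ w ∈ W₁, ∃ q : Q, stepWord δ q w = some p} ≤
      Submodule.span ℝ
        {v : Q → ℝ | ∃ w ∈ wordProd W₂ W₁, v = Matrix.vecMul g (wordMatrix δ w)} := by
  refine Submodule.span_le.2 ?_
  rintro _ ⟨p, ⟨w₁, hw₁, q, hq⟩, rfl⟩
  have hspan := hcomp g (mem_spanOf_univ g) hg hg0 (mem_spanOf_univ (Pi.single q 1))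
  have hmap := Submodule.mem_map_of_mem (f := (wordMatrix δ w₁).vecMulLinear) hspan
  rw [Submodule.map_span] at hmap
  rw [Matrix.vecMulLinear_apply, single_vecMul_wordMatrix δ q p w₁ hq] at hmap
  refine Submodule.span_mono ?_ hmap
  rintro _ ⟨_, ⟨w₂, hw₂, rfl⟩, rfl⟩
  exact ⟨w₂ ++ w₁, ⟨w₂, hw₂, w₁, hw₁, rfl⟩, (vecMul_append δ g w₂ w₁).symm⟩

theorem exists_vecMul_apply_ne_zero_of_mem_span [Fintype Q] {δ : Q → A → Option Q}
    {W : Set (List A)} {g x : Q → ℝ} (l : (Q → ℝ) →ₗ[ℝ] ℝ)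
    (hx : x ∈ Submodule.span ℝ {v : Q → ℝ | ∃ w ∈ W, v = Matrix.vecMul g (wordMatrix δ w)})
    (hl : l x ≠ 0) : ∃ w ∈ W, l (Matrix.vecMul g (wordMatrix δ w)) ≠ 0 := by
  by_contra! h
  refine hl (LinearMap.mem_ker.1 ((Submodule.span_le (p := LinearMap.ker l)).2 ?_ hx))
  rintro _ ⟨w, hw, rfl⟩
  exact h w hw

/-- If `w` maps `S` into `S` and either kills `S` or does not decrease its size, then it acts on `S`
as the zero map or as a permutation, so `χ(S)·M(w)` is constant on `S`. -/
theorem indicator_vecMul_wordMatrix_apply_eq [Fintype Q] (δ : Q → A → Option Q) (S : Set Q)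
    (w : List A) (hsub : img δ S w ⊆ S)
    (hcard : (img δ S w).ncard = 0 ∨ S.ncard ≤ (img δ S w).ncard) {s t : Q}
    (hs : s ∈ S) (ht : t ∈ S) :
    Matrix.vecMul (S.indicator 1) (wordMatrix δ w) s =
      Matrix.vecMul (S.indicator 1) (wordMatrix δ w) t := by
  have hval : ∀ r, Matrix.vecMul (S.indicator 1) (wordMatrix δ w) r =
      ∑ q, if q ∈ S ∧ stepWord δ q w = some r then (1 : ℝ) else 0 := by
    intro r
    refine Finset.sum_congr rfl fun q _ => ?_
    by_cases hq : q ∈ S <;> simp [hq, wordMatrix]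
  rcases hcard with h0 | hle
  · have hempty : img δ S w = ∅ := (Set.ncard_eq_zero (Set.toFinite _)).1 h0
    have hzero : ∀ r, Matrix.vecMul (S.indicator 1) (wordMatrix δ w) r = 0 := by
      intro r
      rw [hval]
      refine Finset.sum_eq_zero fun q _ => if_neg fun hq => ?_
      have : r ∈ img δ S w := ⟨q, hq⟩
      simp [hempty] at this
    rw [hzero, hzero]
  · have himg : img δ S w = S := Set.eq_of_subset_of_ncard_le hsub hle (Set.toFinite _)
    have hsurj : some '' S ⊆ (fun q => stepWord δ q w) '' S := by
      rintro _ ⟨r, hr, rfl⟩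
      rw [← himg] at hr
      exact hr
    have hcard' : ((fun q => stepWord δ q w) '' S).ncard = S.ncard := by
      refine le_antisymm (Set.ncard_image_le (Set.toFinite _)) ?_
      rw [← Set.ncard_image_of_injective S (Option.some_injective Q)]
      exact Set.ncard_le_ncard hsurj (Set.toFinite _)
    have hinj : Set.InjOn (fun q => stepWord δ q w) S :=
      Set.injOn_of_ncard_image_eq hcard' (Set.toFinite _)
    have hone : ∀ r ∈ S, Matrix.vecMul (S.indicator 1) (wordMatrix δ w) r = 1 := by
      intro r hr
      obtain ⟨q, hq, hqr⟩ := hsurj ⟨r, hr, rfl⟩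
      rw [hval, Finset.sum_eq_single q]
      · exact if_pos ⟨hq, hqr⟩
      · intro p _ hpq
        exact if_neg fun hp => hpq (hinj hp.1 hq (hp.2.trans hqr.symm))
      · simp
    rw [hone s hs, hone t ht]

theorem stepWord_wordProd_mem {δ : Q → A → Option Q} {W₁ W₂ : Set (List A)} {u : List A}
    (hu : u ∈ wordProd W₂ W₁) {p q : Q} (h : stepWord δ q u = some p) :
    ∃ w ∈ W₁, ∃ q : Q, stepWord δ q w = some p := by
  obtain ⟨w₂, _, w₁, hw₁, rfl⟩ := hu
  obtain ⟨r, _, hr⟩ := (stepWord_append_eq_some δ q p w₂ w₁).1 h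
  exact ⟨w₁, hw₁, r, hr⟩

theorem img_append (δ : Q → A → Option Q) (S : Set Q) (u v : List A) :
    img δ S (u ++ v) = img δ (img δ S u) v := by
  ext r
  simp only [img, Set.mem_ofPred_eq, stepWord_append_eq_some]
  grind

/-- A family of words `W` mapping `R` to itself whose vectors `g·M(w)` span `V(R)` for every
non-negative non-zero `g` admits a product that resets `R`. -/
theorem exists_flatten_img_ncard_eq_one [Fintype Q] (δ : Q → A → Option Q) (R : Set Q)
    (hRne : R.Nonempty) (W : Set (List A)) (hRW : ∀ u ∈ W, img δ R u ⊆ R)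
    (hspan : ∀ g : Q → ℝ, (∀ i, 0 ≤ g i) → g ≠ 0 → spanOf R ≤
      Submodule.span ℝ {v : Q → ℝ | ∃ w ∈ W, v = Matrix.vecMul g (wordMatrix δ w)}) :
    ∃ ws : List (List A), (∀ u ∈ ws, u ∈ W) ∧ (img δ R ws.flatten).ncard = 1 := by
  have hclosed : ∀ ws : List (List A), (∀ u ∈ ws, u ∈ W) → img δ R ws.flatten ⊆ R := by
    intro ws
    induction ws with
    | nil =>
      rintro _ _ ⟨q, hq, h⟩
      cases h
      exact hq
    | cons u ws ih =>
      intro h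
      rw [List.flatten_cons, img_append]
      rintro p ⟨q, hq, hqp⟩
      exact ih (fun v hv => h v (List.mem_cons_of_mem _ hv))
        ⟨q, hRW u (h u List.mem_cons_self) hq, hqp⟩
  have hex : ∃ k, k ≠ 0 ∧ ∃ ws : List (List A), (∀ u ∈ ws, u ∈ W) ∧
      (img δ R ws.flatten).ncard = k := by
    refine ⟨_, ?_, [], by simp, rfl⟩
    obtain ⟨r, hr⟩ := hRne
    exact Set.ncard_ne_zero_of_mem (a := r) ⟨r, hr, rfl⟩ (Set.toFinite _)
  obtain ⟨hk0, ws, hws, hk⟩ := Nat.find_spec hex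
  have hmin : ∀ vs : List (List A), (∀ u ∈ vs, u ∈ W) → (img δ R vs.flatten).ncard = 0 ∨
      (img δ R ws.flatten).ncard ≤ (img δ R vs.flatten).ncard := by
    intro vs hvs
    by_cases h0 : (img δ R vs.flatten).ncard = 0
    · exact Or.inl h0
    · exact Or.inr (hk ▸ Nat.find_min' hex ⟨h0, vs, hvs, rfl⟩)
  refine ⟨ws, hws, ?_⟩
  rw [← hk] at hk0
  by_contra hne
  obtain ⟨s, hs, t, ht, hst⟩ := (Set.one_lt_ncard (Set.toFinite _)).1
    (show 1 < (img δ R ws.flatten).ncard by omega)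
  have hsR := hs
  obtain ⟨p, hp, hps⟩ := hsR
  set S := img δ R ws.flatten with hS
  let l : (Q → ℝ) →ₗ[ℝ] ℝ :=
    ((LinearMap.proj s : (Q → ℝ) →ₗ[ℝ] ℝ) - LinearMap.proj t) ∘ₗ
      (wordMatrix δ ws.flatten).vecMulLinear
  have hl : ∀ x, l x = Matrix.vecMul x (wordMatrix δ ws.flatten) s -
      Matrix.vecMul x (wordMatrix δ ws.flatten) t := fun _ => rfl
  have hmem := hspan (S.indicator 1) (fun i => Set.indicator_nonneg (by simp) i)
    (fun h => by simpa [hs] using congrFun h s) (Submodule.subset_span ⟨p, hp, rfl⟩)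
  obtain ⟨u, hu, hne⟩ := exists_vecMul_apply_ne_zero_of_mem_span l hmem (by
    rw [hl, single_vecMul_wordMatrix δ p s _ hps]
    simp [hst.symm])
  refine hne ?_
  rw [hl, ← vecMul_append, sub_eq_zero]
  refine indicator_vecMul_wordMatrix_apply_eq δ S _ ?_ ?_ hs ht
  · rw [img_append]
    rintro r ⟨q, ⟨q', hq', hq'q⟩, hqr⟩
    exact ⟨q, hRW u hu ⟨q', hclosed ws hws hq', hq'q⟩, hqr⟩
  · have := hmin (ws ++ u :: ws) (by grind)
    rwa [List.flatten_append, List.flatten_cons, img_append] at this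

/-- if `W₂` is complete for `V(Q) = ℝⁿ`, then `W₂W₁` is complete for `V(R)`,
and the induced automaton `A^{I(W₁,W₂)}` (with states `R` and alphabet `W₂W₁`, acting as
`δ` does) is synchronizing and strongly connected. -/
theorem stmt11 {Q A : Type*} [Fintype Q] (δ : Q → A → Option Q)
    (hsc : StronglyConnected δ)
    (hsync : ∃ w : List A, (img δ Set.univ w).ncard = 1)
    (W₁ W₂ : Set (List A)) (hW₁ : W₁.Nonempty) (hW₂ : W₂.Nonempty)
    (R : Set Q) (hR : R = {p : Q | ∃ w ∈ W₁, ∃ q : Q, stepWord δ q w = some p})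
    (hRne : R.Nonempty)
    (hcomp : CompleteFor δ W₂ (spanOf (Set.univ : Set Q))) :
    CompleteFor δ (wordProd W₂ W₁) (spanOf R) ∧
    (∃ ws : List (List A), (∀ u ∈ ws, u ∈ wordProd W₂ W₁) ∧
      (img δ R ws.flatten).ncard = 1) ∧
    (∀ p ∈ R, ∀ q ∈ R, ∃ ws : List (List A),
      (∀ u ∈ ws, u ∈ wordProd W₂ W₁) ∧ stepWord δ p ws.flatten = some q) := by
  subst hR
  have hspan := spanOf_le_span_wordProd δ W₁ W₂ hcomp
  refine ⟨fun g _ => hspan g, ?_, fun p _ q hq => ?_⟩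
  · exact exists_flatten_img_ncard_eq_one δ _ hRne _
      (fun u hu r ⟨_, _, h⟩ => stepWord_wordProd_mem hu h) hspan
  · have hnonneg : (0 : Q → ℝ) ≤ Pi.single p 1 := Pi.single_nonneg.2 zero_le_one
    have hmem := hspan (Pi.single p 1) hnonneg (by simp)
      (Submodule.subset_span ⟨q, hq, rfl⟩)
    obtain ⟨u, hu, hne⟩ := exists_vecMul_apply_ne_zero_of_mem_span (LinearMap.proj q) hmem
      (by simp)
    rw [LinearMap.proj_apply, single_vecMul_wordMatrix_apply] at hne
    exact ⟨[u], by simpa using hu, by simpa using hne⟩
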